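/- Calderón's duality theorem, first inclusion: Let (X₀,X₁) be a regular Banach couple and θ ∈ (0,1). If y ∈ [X₀^#,X₁^#]^θ, then y ∈ ([X₀,X₁]_θ)^# and ‖y‖_{([X₀,X₁]_θ)^#} ≤ ‖y‖_{[X₀^#,X₁^#]^θ}; i.e., |⟨x,y⟩| ≤ ‖y‖_{[X₀^#,X₁^#]^θ} · ‖x‖_{[X₀,X₁]_θ} for all x ∈ X₀ ∩ X₁. -/

import Mathlib

open Complex Set
open scoped Real

/-- The open unit strip. -/
def Sopen : Set ℂ := {z : ℂ | 0 < z.re ∧ z.re < 1}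

variable {X0 X1 E : Type*}
  [NormedAddCommGroup X0] [NormedSpace ℂ X0]
  [NormedAddCommGroup X1] [NormedSpace ℂ X1]
  [NormedAddCommGroup E] [NormedSpace ℂ E]

/-- The disk version `F_𝔻(X₀, X₁)` of Calderón's function space (for the parameter `θ`):
`f : 𝔻 → X₀ + X₁` continuous on the closed disk, analytic in its interior, vanishing at
`1` and `e^{2πθi}`, whose restriction to the closed arc `Γ̄ⱼ` is a continuous `Xⱼ`-valued
function (`Γ̄₀` parametrized by `t ∈ [2πθ, 2π]`, `Γ̄₁` by `t ∈ [0, 2πθ]`).  The Banach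
couple `(X₀, X₁)` is given by continuous injections `i0, i1` into the space `E` playing
the role of `X₀ + X₁`. -/
structure CalderonDiskFun (θ : ℝ) (i0 : X0 →L[ℂ] E) (i1 : X1 →L[ℂ] E) where
  toFun : ℂ → E
  g0 : ℝ → X0
  g1 : ℝ → X1
  cont : ContinuousOn toFun (Metric.closedBall (0:ℂ) 1)
  anal : DifferentiableOn ℂ toFun (Metric.ball (0:ℂ) 1)
  vanish_one : toFun 1 = 0
  vanish_theta : toFun (Complex.exp ((2 * π * θ : ℝ) * I)) = 0
  cont_g0 : ContinuousOn g0 (Icc (2 * π * θ) (2 * π))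
  cont_g1 : ContinuousOn g1 (Icc 0 (2 * π * θ))
  eq_g0 : ∀ t ∈ Icc (2 * π * θ) (2 * π), i0 (g0 t) = toFun (Complex.exp ((t:ℝ) * I))
  eq_g1 : ∀ t ∈ Icc (0:ℝ) (2 * π * θ), i1 (g1 t) = toFun (Complex.exp ((t:ℝ) * I))

/-- The norm `‖f‖_{F_𝔻} = max (sup_{Γ₀} ‖f‖_{X₀}, sup_{Γ₁} ‖f‖_{X₁})`. -/
noncomputable def CalderonDiskFun.norm {θ : ℝ} {i0 : X0 →L[ℂ] E} {i1 : X1 →L[ℂ] E}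
    (f : CalderonDiskFun θ i0 i1) : ℝ :=
  max (sSup ((fun t => ‖f.g0 t‖) '' Icc (2 * π * θ) (2 * π)))
    (sSup ((fun t => ‖f.g1 t‖) '' Icc 0 (2 * π * θ)))

/-- The norm of Calderón's complex interpolation space `[X₀, X₁]_θ` (disk description):
`‖x‖_θ = inf {‖f‖_{F_𝔻} : f ∈ F_𝔻(X₀,X₁), f(0) = x}`. -/
noncomputable def interpNorm (θ : ℝ) (i0 : X0 →L[ℂ] E) (i1 : X1 →L[ℂ] E) (x : E) : ℝ :=
  sInf {r | ∃ f : CalderonDiskFun θ i0 i1, f.toFun 0 = x ∧ r = f.norm}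

/-- The intersection `X₀ ∩ X₁`, realized as the submodule of `X₀ × X₁` of pairs that
agree in `X₀ + X₁`. -/
def interSub (i0 : X0 →L[ℂ] E) (i1 : X1 →L[ℂ] E) : Submodule ℂ (X0 × X1) where
  carrier := {p | i0 p.1 = i1 p.2}
  add_mem' := by
    intro a b ha hb
    simp only [Set.mem_setOf_eq] at *
    simp [map_add, ha, hb]
  zero_mem' := by simp
  smul_mem' := by
    intro c a ha
    simp only [Set.mem_setOf_eq] at *
    simp [map_smul, ha]

/-- The restriction of the norm of `X₀` to `X₀ ∩ X₁`. -/
noncomputable def nzero (i0 : X0 →L[ℂ] E) (i1 : X1 →L[ℂ] E) (p : interSub i0 i1) : ℝ :=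
  ‖(p : X0 × X1).1‖

/-- The restriction of the norm of `X₁` to `X₀ ∩ X₁`. -/
noncomputable def none' (i0 : X0 →L[ℂ] E) (i1 : X1 →L[ℂ] E) (p : interSub i0 i1) : ℝ :=
  ‖(p : X0 × X1).2‖

/-- Membership in the space `ℋ(X₀^#, X₁^#)` (realized via linear functionals on
`X₀ ∩ X₁`): `h : S° → X₀^# + X₁^# = (X₀ ∩ X₁)^#` with `z ↦ ⟨b, h(z)⟩ ∈ H^∞(S°)` for each
`b ∈ X₀ ∩ X₁` and `|⟨b, h(z)⟩| ≤ C ‖b‖_{X₀}^{1−Re z} ‖b‖_{X₁}^{Re z}`. -/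
def MemH (i0 : X0 →L[ℂ] E) (i1 : X1 →L[ℂ] E)
    (h : ℂ → (interSub i0 i1 →ₗ[ℂ] ℂ)) : Prop :=
  (∀ z ∈ Sopen, ∃ C : ℝ, ∀ b : interSub i0 i1,
    ‖h z b‖ ≤ C * max (nzero i0 i1 b) (none' i0 i1 b)) ∧
  (∀ b : interSub i0 i1, DifferentiableOn ℂ (fun z => h z b) Sopen ∧
    ∃ B : ℝ, ∀ z ∈ Sopen, ‖h z b‖ ≤ B) ∧
  (∃ C : ℝ, ∀ b : interSub i0 i1, ∀ z ∈ Sopen,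
    ‖h z b‖ ≤ C * nzero i0 i1 b ^ (1 - z.re) * none' i0 i1 b ^ z.re)

/-- The norm `‖h‖_{ℋ(X₀^#, X₁^#)} = inf C` over admissible constants `C`. -/
noncomputable def HNorm (i0 : X0 →L[ℂ] E) (i1 : X1 →L[ℂ] E)
    (h : ℂ → (interSub i0 i1 →ₗ[ℂ] ℂ)) : ℝ :=
  sInf {C | 0 ≤ C ∧ ∀ b : interSub i0 i1, ∀ z ∈ Sopen,
    ‖h z b‖ ≤ C * nzero i0 i1 b ^ (1 - z.re) * none' i0 i1 b ^ z.re}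

/-- `‖y‖_{[X₀^#,X₁^#]^θ} = inf {‖h‖_ℋ : h ∈ ℋ(X₀^#,X₁^#), h(θ) = y}`. -/
noncomputable def upperNorm (θ : ℝ) (i0 : X0 →L[ℂ] E) (i1 : X1 →L[ℂ] E)
    (y : interSub i0 i1 →ₗ[ℂ] ℂ) : ℝ :=
  sInf {r | ∃ h, MemH i0 i1 h ∧ h ((θ:ℝ) : ℂ) = y ∧ r = HNorm i0 i1 h}

/-- `‖y‖_{([X₀,X₁]_θ)^#} = sup {|⟨x,y⟩| : x ∈ X₀ ∩ X₁, ‖x‖_{[X₀,X₁]_θ} ≤ 1}`. -/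
noncomputable def interpDualNorm (θ : ℝ) (i0 : X0 →L[ℂ] E) (i1 : X1 →L[ℂ] E)
    (y : interSub i0 i1 →ₗ[ℂ] ℂ) : ℝ :=
  sSup {r | ∃ p : interSub i0 i1,
    interpNorm θ i0 i1 (i0 (p : X0 × X1).1) ≤ 1 ∧ r = ‖y p‖}

open MeasureTheory Filter Topology

section GaussianMollifier

variable {V : Type*} [NormedAddCommGroup V] [NormedSpace ℂ V]

/-- The entire function obtained by convolving `k`, viewed as a function on the imaginary axis,
with the Gaussian of parameter `n`. -/
noncomputable def gaussMoll (n : ℝ) (k : ℝ → V) (z : ℂ) : V :=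
  ((√(n / π) : ℝ) : ℂ) • ∫ t : ℝ, cexp (n * (z - t * I) ^ 2) • k t

lemma norm_gaussKernel (n : ℝ) (z : ℂ) (t : ℝ) :
    ‖cexp (n * (z - t * I) ^ 2)‖ = Real.exp (n * z.re ^ 2) * Real.exp (-n * (t - z.im) ^ 2) := by
  rw [Complex.norm_exp, ← Real.exp_add]
  congr 1
  simp [pow_two]
  ring

lemma integrable_gaussian_translate {n : ℝ} (hn : 0 < n) (σ : ℝ) :
    Integrable fun t : ℝ => Real.exp (-n * (t - σ) ^ 2) :=
  (integrable_exp_neg_mul_sq hn).comp_sub_right σ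

lemma sqrt_mul_integral_gaussian_translate {n : ℝ} (hn : 0 < n) (σ : ℝ) :
    √(n / π) * ∫ t : ℝ, Real.exp (-n * (t - σ) ^ 2) = 1 := by
  rw [integral_sub_right_eq_self (fun t : ℝ => Real.exp (-n * t ^ 2)) σ, integral_gaussian,
    ← Real.sqrt_mul (by positivity), div_mul_div_cancel₀ Real.pi_ne_zero, div_self hn.ne',
    Real.sqrt_one]

lemma integrable_gaussKernel_smul {n : ℝ} (hn : 0 < n) {k : ℝ → V} (hk : Continuous k) {B : ℝ}
    (hB : ∀ t, ‖k t‖ ≤ B) (z : ℂ) :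
    Integrable fun t : ℝ => cexp (n * (z - t * I) ^ 2) • k t := by
  refine Integrable.mono'
    (((integrable_gaussian_translate hn z.im).const_mul (Real.exp (n * z.re ^ 2))).mul_const B)
    (by fun_prop) (Eventually.of_forall fun t => ?_)
  rw [norm_smul, norm_gaussKernel]
  gcongr
  exact hB t

lemma norm_gaussMoll_le {n : ℝ} (hn : 0 < n) {k : ℝ → V} {B : ℝ}
    (hB : ∀ t, ‖k t‖ ≤ B) (z : ℂ) :
    ‖gaussMoll n k z‖ ≤ Real.exp (n * z.re ^ 2) * B := by
  have key : ‖∫ t : ℝ, cexp (n * (z - t * I) ^ 2) • k t‖ ≤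
      ∫ t : ℝ, Real.exp (n * z.re ^ 2) * Real.exp (-n * (t - z.im) ^ 2) * B := by
    refine norm_integral_le_of_norm_le
      (((integrable_gaussian_translate hn z.im).const_mul (Real.exp (n * z.re ^ 2))).mul_const B)
      (Eventually.of_forall fun t => ?_)
    rw [norm_smul, norm_gaussKernel]
    gcongr
    exact hB t
  rw [integral_mul_const, integral_const_mul] at key
  rw [gaussMoll, norm_smul, Complex.norm_real, Real.norm_of_nonneg (Real.sqrt_nonneg _)]
  calc _ ≤ √(n / π) * (Real.exp (n * z.re ^ 2) *
        (∫ t : ℝ, Real.exp (-n * (t - z.im) ^ 2)) * B) := by gcongr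
    _ = (√(n / π) * ∫ t : ℝ, Real.exp (-n * (t - z.im) ^ 2)) * (Real.exp (n * z.re ^ 2) * B) := by
        ring
    _ = _ := by rw [sqrt_mul_integral_gaussian_translate hn, one_mul]

lemma differentiable_gaussMoll [CompleteSpace V] {n : ℝ} (hn : 0 < n) {k : ℝ → V}
    (hk : Continuous k) {B : ℝ} (hB : ∀ t, ‖k t‖ ≤ B) : Differentiable ℂ (gaussMoll n k) := by
  have hB0 : 0 ≤ B := (norm_nonneg _).trans (hB 0)
  refine Differentiable.const_smul (fun z₀ => ?_) _
  set R : ℝ := ‖z₀‖ + 1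
  have hn2 : 0 < n / 2 := by positivity
  refine (hasDerivAt_integral_of_dominated_loc_of_deriv_le
    (F := fun (z : ℂ) (t : ℝ) => cexp (n * (z - t * I) ^ 2) • k t)
    (F' := fun (z : ℂ) (t : ℝ) =>
      (cexp (n * (z - t * I) ^ 2) * (n * (2 * (z - t * I)))) • k t)
    (bound := fun t => (Real.exp (2 * n * R ^ 2) * (n * 2) * B) *
      (R * Real.exp (-(n / 2) * t ^ 2) + ‖t * Real.exp (-(n / 2) * t ^ 2)‖))
    (Metric.ball_mem_nhds z₀ one_pos)
    (Eventually.of_forall fun z => by fun_prop)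
    (integrable_gaussKernel_smul hn hk hB z₀) (by fun_prop)
    (Eventually.of_forall fun t z hz => ?_)
    ((((integrable_exp_neg_mul_sq hn2).const_mul R).add
      (integrable_mul_exp_neg_mul_sq hn2).norm).const_mul _)
    (Eventually.of_forall fun t z _ => ?_)).2.differentiableAt
  · have hzR : ‖z‖ ≤ R := by
      have : ‖z‖ ≤ ‖z₀‖ + ‖z - z₀‖ := by simpa using norm_add_le z₀ (z - z₀)
      have := mem_ball_iff_norm.1 hz
      simp only [R]
      linarith
    have hre : z.re ^ 2 + z.im ^ 2 ≤ R ^ 2 := by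
      have : ‖z‖ ^ 2 ≤ R ^ 2 := by gcongr
      rw [← Complex.normSq_eq_norm_sq, Complex.normSq_apply] at this
      linarith
    have hk1 : ‖cexp (n * (z - t * I) ^ 2)‖ ≤
        Real.exp (2 * n * R ^ 2) * Real.exp (-(n / 2) * t ^ 2) := by
      rw [norm_gaussKernel, ← Real.exp_add, ← Real.exp_add, Real.exp_le_exp]
      have : z.re ^ 2 - (t - z.im) ^ 2 ≤ 2 * R ^ 2 - 1 / 2 * t ^ 2 := by
        nlinarith [sq_nonneg (t - 2 * z.im), sq_nonneg z.re, sq_nonneg z.im]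
      nlinarith
    have hk2 : ‖z - t * I‖ ≤ R + |t| := by
      refine (norm_sub_le _ _).trans ?_
      simpa using hzR
    rw [norm_smul, norm_mul, norm_mul, norm_mul, Complex.norm_real, Real.norm_of_nonneg hn.le,
      norm_mul, Real.norm_of_nonneg (Real.exp_pos _).le, Real.norm_eq_abs]
    calc _ ≤ Real.exp (2 * n * R ^ 2) * Real.exp (-(n / 2) * t ^ 2) *
          (n * (2 * (R + |t|))) * B := by
          gcongr
          · simp
          · exact hB t
      _ = _ := by ring
  · have h1 : HasDerivAt (fun z : ℂ => (n : ℂ) * (z - t * I) ^ 2) (n * (2 * (z - t * I))) z := by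
      simpa using ((((hasDerivAt_id z).sub_const (t * I)).pow 2).const_mul (n : ℂ))
    exact h1.cexp.smul_const (k t)

lemma integral_abs_mul_gaussian {n : ℝ} (hn : 0 < n) :
    ∫ t : ℝ, |t| * Real.exp (-n * t ^ 2) = 1 / n := by
  have h1 : ∫ t : ℝ in Ioi 0, t * Real.exp (-n * t ^ 2) = (2 * n)⁻¹ := by
    have h := integral_mul_cexp_neg_mul_sq (b := (n : ℂ)) (by simpa using hn)
    have h2 : ∀ r : ℝ, (r : ℂ) * cexp (-n * (r : ℂ) ^ 2) =
        ((r * Real.exp (-n * r ^ 2) : ℝ) : ℂ) := fun r => by push_cast; rfl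
    simp_rw [h2] at h
    rw [integral_complex_ofReal] at h
    exact_mod_cast h
  have h2 := integral_comp_abs (f := fun t : ℝ => t * Real.exp (-n * t ^ 2))
  simp only [sq_abs] at h2
  rw [h2, h1]
  field_simp

/-- A bound for `p + φ k` on the imaginary axis passes to `p + φ (k * G)` for a Lipschitz
multiplier `φ`, up to an error that vanishes as the Gaussian concentrates. -/
lemma norm_add_smul_gaussMoll_le [CompleteSpace V] {n : ℝ} (hn : 0 < n) {k : ℝ → V}
    (hk : Continuous k) {B : ℝ} (hB : ∀ t, ‖k t‖ ≤ B) {φ : ℝ → ℂ} {Λ : ℝ}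
    (hφ : ∀ s t, ‖φ s - φ t‖ ≤ Λ * |t - s|) {p : V} {M : ℝ} (hM : ∀ t, ‖p + φ t • k t‖ ≤ M)
    (σ : ℝ) :
    ‖p + φ σ • gaussMoll n k (σ * I)‖ ≤ M + Λ * B * (√(n / π) * (1 / n)) := by
  have hB0 : 0 ≤ B := (norm_nonneg _).trans (hB 0)
  set c : ℝ := √(n / π)
  have hker : ∀ t : ℝ, cexp (n * (σ * I - t * I) ^ 2) =
      ((Real.exp (-n * (t - σ) ^ 2) : ℝ) : ℂ) := fun t => by
    push_cast
    congr 1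
    linear_combination (n * (σ - t : ℂ) ^ 2) * I_sq
  have hint := integrable_gaussKernel_smul hn hk hB (σ * I)
  have hG := integrable_gaussian_translate hn σ
  have hGabs : Integrable fun t : ℝ => |t - σ| * Real.exp (-n * (t - σ) ^ 2) := by
    have := (integrable_mul_exp_neg_mul_sq hn).norm.comp_sub_right σ
    simpa [abs_mul] using this
  have hGC : Integrable fun t : ℝ => ((Real.exp (-n * (t - σ) ^ 2) : ℝ) : ℂ) • p :=
    hG.ofReal.smul_const p
  have hone : (c : ℂ) • ∫ t : ℝ, ((Real.exp (-n * (t - σ) ^ 2) : ℝ) : ℂ) • p = p := by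
    rw [integral_smul_const, integral_complex_ofReal, smul_smul, ← Complex.ofReal_mul,
      sqrt_mul_integral_gaussian_translate hn, Complex.ofReal_one, one_smul]
  simp only [hker] at hint
  have heq : p + φ σ • gaussMoll n k (σ * I) =
      (c : ℂ) • ∫ t : ℝ, ((Real.exp (-n * (t - σ) ^ 2) : ℝ) : ℂ) • (p + φ σ • k t) := by
    have hsplit : ∀ t : ℝ, ((Real.exp (-n * (t - σ) ^ 2) : ℝ) : ℂ) • (p + φ σ • k t) =
        ((Real.exp (-n * (t - σ) ^ 2) : ℝ) : ℂ) • p +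
          φ σ • (((Real.exp (-n * (t - σ) ^ 2) : ℝ) : ℂ) • k t) := fun t => by
      rw [smul_add, smul_comm]
    simp_rw [hsplit]
    have hintφ : Integrable fun t : ℝ =>
        φ σ • (((Real.exp (-n * (t - σ) ^ 2) : ℝ) : ℂ) • k t) := hint.smul (φ σ)
    rw [integral_add hGC hintφ, integral_smul, smul_add, hone, gaussMoll,
      smul_comm (φ σ)]
    simp only [hker]
    rfl
  have hbd : ‖∫ t : ℝ, ((Real.exp (-n * (t - σ) ^ 2) : ℝ) : ℂ) • (p + φ σ • k t)‖ ≤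
      ∫ t : ℝ, (M * Real.exp (-n * (t - σ) ^ 2) +
        Λ * B * (|t - σ| * Real.exp (-n * (t - σ) ^ 2))) := by
    refine norm_integral_le_of_norm_le ((hG.const_mul M).add (hGabs.const_mul (Λ * B)))
      (Eventually.of_forall fun t => ?_)
    have h1 : ‖p + φ σ • k t‖ ≤ M + Λ * |t - σ| * B := by
      have : p + φ σ • k t = (p + φ t • k t) + (φ σ - φ t) • k t := by
        rw [sub_smul]; abel
      rw [this]
      refine (norm_add_le _ _).trans (add_le_add (hM t) ?_)
      rw [norm_smul]
      exact mul_le_mul (hφ σ t) (hB t) (norm_nonneg _) ((norm_nonneg _).trans (hφ σ t))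
    rw [norm_smul, Complex.norm_real, Real.norm_of_nonneg (Real.exp_pos _).le]
    calc _ ≤ Real.exp (-n * (t - σ) ^ 2) * (M + Λ * |t - σ| * B) := by gcongr
      _ = _ := by ring
  rw [integral_add (hG.const_mul M) (hGabs.const_mul (Λ * B)), integral_const_mul,
    integral_const_mul,
    integral_sub_right_eq_self (fun t : ℝ => |t| * Real.exp (-n * t ^ 2)) σ,
    integral_abs_mul_gaussian hn] at hbd
  rw [heq, norm_smul, Complex.norm_real, Real.norm_of_nonneg (Real.sqrt_nonneg _)]
  calc _ ≤ c * (M * (∫ t : ℝ, Real.exp (-n * (t - σ) ^ 2)) + Λ * B * (1 / n)) := by gcongr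
    _ = M * (c * ∫ t : ℝ, Real.exp (-n * (t - σ) ^ 2)) + Λ * B * (c * (1 / n)) := by ring
    _ = _ := by rw [sqrt_mul_integral_gaussian_translate hn, mul_one]

lemma tendsto_sqrt_div_pi_mul_one_div :
    Tendsto (fun n : ℝ => √(n / π) * (1 / n)) atTop (𝓝 0) := by
  have h : Tendsto (fun n : ℝ => (√(n * π))⁻¹) atTop (𝓝 0) :=
    tendsto_inv_atTop_zero.comp
      (Real.tendsto_sqrt_atTop.comp (tendsto_id.atTop_mul_const Real.pi_pos))
  refine h.congr' ?_
  filter_upwards [eventually_gt_atTop 0] with n hn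
  rw [Real.sqrt_mul hn.le, Real.sqrt_div hn.le]
  have h1 : √n ≠ 0 := (Real.sqrt_pos.2 hn).ne'
  have h2 : √π ≠ 0 := (Real.sqrt_pos.2 Real.pi_pos).ne'
  field_simp
  rw [Real.sq_sqrt hn.le]

/-- Contour shift: the Gaussian mollifications of the two boundary functions of a bounded analytic
function on the strip agree. -/
lemma gaussMoll_boundary_eq [CompleteSpace V] {n : ℝ} (hn : 0 < n) {K : ℂ → V}
    (hK : ContinuousOn K (re ⁻¹' Icc 0 1)) (hd : DifferentiableOn ℂ K (re ⁻¹' Ioo 0 1)) {B : ℝ}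
    (hB : ∀ z ∈ re ⁻¹' Icc (0 : ℝ) 1, ‖K z‖ ≤ B) (z : ℂ) :
    gaussMoll n (fun t => K (t * I)) z = gaussMoll n (fun t => K (1 + t * I)) (z - 1) := by
  have hB0 : 0 ≤ B := (norm_nonneg _).trans (hB 0 (by simp))
  unfold gaussMoll
  congr 1
  set f : ℂ → V := fun ζ => cexp (n * (z - ζ) ^ 2) • K ζ with hf
  have hcont0 : Continuous fun t : ℝ => K (t * I) :=
    hK.comp_continuous (by fun_prop) (fun t => by simp)
  have hcont1 : Continuous fun t : ℝ => K (1 + t * I) :=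
    hK.comp_continuous (by fun_prop) (fun t => by simp)
  have hi0 := integrable_gaussKernel_smul hn hcont0 (fun t => hB _ (by simp)) z
  have hi1 := integrable_gaussKernel_smul hn hcont1 (fun t => hB _ (by simp)) (z - 1)
  have e1 : (fun t : ℝ => cexp (n * (z - 1 - t * I) ^ 2) • K (1 + t * I)) =
      fun t : ℝ => f (1 + t * I) := by
    funext t; simp only [hf]; congr 3; ring
  rw [e1] at hi1 ⊢
  have hrect : ∀ T : ℝ, 0 < T →
      (∫ x : ℝ in (0 : ℝ)..1, f (x + (-T : ℝ) * I)) - (∫ x : ℝ in (0 : ℝ)..1, f (x + T * I)) +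
      I • (∫ y : ℝ in (-T)..T, f (1 + y * I)) - I • (∫ y : ℝ in (-T)..T, f (y * I)) = 0 := by
    intro T hT
    have h := integral_boundary_rect_eq_zero_of_continuousOn_of_differentiableOn f
      ((-T : ℝ) * I) (1 + T * I) ?_ ?_
    · simpa using h
    · refine ContinuousOn.smul (by fun_prop) (hK.mono fun ζ hζ => ?_)
      have := hζ.1
      simpa using this
    · refine DifferentiableOn.smul (by fun_prop) (hd.mono fun ζ hζ => ?_)
      have := hζ.1
      simpa using this
  have hhor : ∀ τ : ℝ → ℝ, Tendsto (fun T => (τ T - z.im) ^ 2) atTop atTop →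
      Tendsto (fun T => ∫ x : ℝ in (0 : ℝ)..1, f (x + τ T * I)) atTop (𝓝 0) := by
    intro τ hτ
    set R : ℝ := |z.re| + 1
    have hlim : Tendsto (fun T => Real.exp (n * R ^ 2) * Real.exp (-n * (τ T - z.im) ^ 2) * B)
        atTop (𝓝 0) := by
      have : Tendsto (fun T => Real.exp (-n * (τ T - z.im) ^ 2)) atTop (𝓝 0) :=
        Real.tendsto_exp_atBot.comp (hτ.const_mul_atTop_of_neg (by linarith))
      simpa using (this.const_mul (Real.exp (n * R ^ 2))).mul_const B
    refine squeeze_zero_norm (fun T => ?_) hlim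
    have := intervalIntegral.norm_integral_le_of_norm_le_const (a := (0 : ℝ)) (b := 1)
      (f := fun x : ℝ => f (x + τ T * I))
      (C := Real.exp (n * R ^ 2) * Real.exp (-n * (τ T - z.im) ^ 2) * B) (fun x hx => ?_)
    · simpa using this
    · rw [uIoc_of_le zero_le_one] at hx
      have hKx := hB (x + τ T * I) (by simpa using ⟨hx.1.le, hx.2⟩)
      have hkx : ‖cexp (n * (z - (x + τ T * I)) ^ 2)‖ ≤
          Real.exp (n * R ^ 2) * Real.exp (-n * (τ T - z.im) ^ 2) := by
        have := norm_gaussKernel n (z - x) (τ T)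
        rw [← sub_sub, this]
        have h2 : |z.re - x| ≤ R := by
          refine (abs_sub _ _).trans ?_
          rw [abs_of_pos hx.1]
          simp only [R]
          linarith [hx.2]
        have h3 : (z.re - x) ^ 2 ≤ R ^ 2 := sq_le_sq' (by linarith [(abs_le.1 h2).1])
          (abs_le.1 h2).2
        simp only [sub_re, ofReal_re, sub_im, ofReal_im, sub_zero]
        gcongr
      simp only [hf]
      rw [norm_smul]
      gcongr
  have hsq : Tendsto (fun x : ℝ => x ^ 2) atTop atTop := tendsto_pow_atTop two_ne_zero
  have h1 := hhor (fun T => T) (hsq.comp (tendsto_atTop_add_const_right _ (-z.im) tendsto_id))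
  have h2 := hhor (fun T => -T) (by
    refine (hsq.comp (tendsto_atTop_add_const_right _ z.im tendsto_id)).congr fun T => ?_
    simp only [Function.comp, id]
    ring)
  have h3 := (intervalIntegral_tendsto_integral hi1 tendsto_neg_atTop_atBot tendsto_id).const_smul I
  have h4 := (intervalIntegral_tendsto_integral hi0 tendsto_neg_atTop_atBot tendsto_id).const_smul I
  have hsum := ((h2.sub h1).add h3).sub h4
  have hz := tendsto_nhds_unique (hsum.congr' (by
    filter_upwards [eventually_gt_atTop 0] with T hT
    exact hrect T hT)) tendsto_const_nhds
  rw [sub_zero, zero_add, ← smul_sub, smul_eq_zero, sub_eq_zero] at hz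
  exact (hz.resolve_left I_ne_zero).symm

end GaussianMollifier

section ConformalMap

/-- The Möbius map from the upper half plane onto the unit disk sending `e^{πθi}` to `0`,
`∞` to `1` and `0` to `e^{2πθi}`. -/
noncomputable def halfPlaneToDisk (θ : ℝ) (w : ℂ) : ℂ :=
  (w - (Real.cos (π * θ) + Real.sin (π * θ) * I)) / (w - (Real.cos (π * θ) - Real.sin (π * θ) * I))

/-- The conformal map from the unit strip onto the unit disk sending `θ` to `0`. -/
noncomputable def stripToDisk (θ : ℝ) (z : ℂ) : ℂ := halfPlaneToDisk θ (cexp (π * I * z))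

/-- The argument in `(0, 2π)` of the image of a real point under `halfPlaneToDisk`. -/
noncomputable def boundaryAngle (θ w : ℝ) : ℝ :=
  π + 2 * Real.arctan ((w - Real.cos (π * θ)) / Real.sin (π * θ))

variable {θ : ℝ}

lemma sin_pi_mul_pos (hθ : θ ∈ Ioo (0 : ℝ) 1) : 0 < Real.sin (π * θ) :=
  Real.sin_pos_of_pos_of_lt_pi (mul_pos Real.pi_pos hθ.1)
    (by nlinarith [Real.pi_pos, hθ.2])

lemma halfPlaneToDisk_den_ne_zero (hθ : θ ∈ Ioo (0 : ℝ) 1) {w : ℂ} (hw : 0 ≤ w.im) :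
    w - (Real.cos (π * θ) - Real.sin (π * θ) * I) ≠ 0 := by
  intro h
  have h2 := congrArg Complex.im h
  simp only [sub_im, ofReal_im, mul_im, ofReal_re, I_im, I_re, zero_im, mul_zero, mul_one,
    add_zero, zero_sub, sub_neg_eq_add] at h2
  linarith [sin_pi_mul_pos hθ]

lemma norm_halfPlaneToDisk_le_one (hθ : θ ∈ Ioo (0 : ℝ) 1) {w : ℂ} (hw : 0 ≤ w.im) :
    ‖halfPlaneToDisk θ w‖ ≤ 1 := by
  rw [halfPlaneToDisk, norm_div, div_le_one (norm_pos_iff.2 (halfPlaneToDisk_den_ne_zero hθ hw)),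
    ← sq_le_sq₀ (norm_nonneg _) (norm_nonneg _), ← Complex.normSq_eq_norm_sq,
    ← Complex.normSq_eq_norm_sq, Complex.normSq_apply, Complex.normSq_apply]
  simp only [sub_re, add_re, ofReal_re, mul_re, I_re, I_im, ofReal_im, sub_im, add_im, mul_im]
  nlinarith [mul_nonneg hw (sin_pi_mul_pos hθ).le]

lemma norm_halfPlaneToDisk_lt_one (hθ : θ ∈ Ioo (0 : ℝ) 1) {w : ℂ} (hw : 0 < w.im) :
    ‖halfPlaneToDisk θ w‖ < 1 := by
  rw [halfPlaneToDisk, norm_div,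
    div_lt_one (norm_pos_iff.2 (halfPlaneToDisk_den_ne_zero hθ hw.le)),
    ← sq_lt_sq₀ (norm_nonneg _) (norm_nonneg _), ← Complex.normSq_eq_norm_sq,
    ← Complex.normSq_eq_norm_sq, Complex.normSq_apply, Complex.normSq_apply]
  simp only [sub_re, add_re, ofReal_re, mul_re, I_re, I_im, ofReal_im, sub_im, add_im, mul_im]
  nlinarith [mul_pos hw (sin_pi_mul_pos hθ)]

lemma hasDerivAt_halfPlaneToDisk (hθ : θ ∈ Ioo (0 : ℝ) 1) {w : ℂ} (hw : 0 ≤ w.im) :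
    HasDerivAt (halfPlaneToDisk θ) ((2 * Real.sin (π * θ) * I) /
      (w - (Real.cos (π * θ) - Real.sin (π * θ) * I)) ^ 2) w := by
  have h := ((hasDerivAt_id w).sub_const (Real.cos (π * θ) + Real.sin (π * θ) * I : ℂ)).fun_div
    ((hasDerivAt_id w).sub_const (Real.cos (π * θ) - Real.sin (π * θ) * I : ℂ))
    (halfPlaneToDisk_den_ne_zero hθ hw)
  refine h.congr_deriv ?_
  simp only [id]
  ring

lemma halfPlaneToDisk_ofReal (hθ : θ ∈ Ioo (0 : ℝ) 1) (w : ℝ) :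
    halfPlaneToDisk θ w = cexp (boundaryAngle θ w * I) := by
  have hs := sin_pi_mul_pos hθ
  set v : ℝ := (w - Real.cos (π * θ)) / Real.sin (π * θ) with hv
  have hw : w = Real.cos (π * θ) + Real.sin (π * θ) * v := by rw [hv]; field_simp; ring
  have hpos : (0 : ℝ) < 1 + v ^ 2 := by positivity
  have hcos : Real.cos (boundaryAngle θ w) = (v ^ 2 - 1) / (1 + v ^ 2) := by
    rw [boundaryAngle, add_comm, Real.cos_add_pi, Real.cos_two_mul, Real.cos_sq_arctan, ← hv]
    field_simp
    ring
  have hsin : Real.sin (boundaryAngle θ w) = -(2 * v) / (1 + v ^ 2) := by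
    rw [boundaryAngle, add_comm, Real.sin_add_pi, Real.sin_two_mul, ← hv, Real.sin_arctan,
      Real.cos_arctan]
    have : √(1 + v ^ 2) ^ 2 = 1 + v ^ 2 := Real.sq_sqrt hpos.le
    field_simp
    rw [this]
  have hden := halfPlaneToDisk_den_ne_zero hθ (w := (w : ℂ)) (by simp)
  have hpos' : (1 + (v : ℂ) ^ 2) ≠ 0 := by exact_mod_cast hpos.ne'
  rw [Complex.exp_mul_I, ← Complex.ofReal_cos, ← Complex.ofReal_sin, hcos, hsin, halfPlaneToDisk,
    div_eq_iff hden, hw]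
  push_cast
  field_simp
  ring_nf
  simp only [I_sq]
  ring

lemma boundaryAngle_lt (w : ℝ) : boundaryAngle θ w < 2 * π := by
  have := Real.arctan_lt_pi_div_two ((w - Real.cos (π * θ)) / Real.sin (π * θ))
  rw [boundaryAngle]
  linarith

lemma boundaryAngle_pos (w : ℝ) : 0 < boundaryAngle θ w := by
  have := Real.neg_pi_div_two_lt_arctan ((w - Real.cos (π * θ)) / Real.sin (π * θ))
  rw [boundaryAngle]
  linarith

lemma boundaryAngle_zero (hθ : θ ∈ Ioo (0 : ℝ) 1) : boundaryAngle θ 0 = 2 * π * θ := by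
  have h : (0 - Real.cos (π * θ)) / Real.sin (π * θ) = Real.tan (π * θ - π / 2) := by
    rw [Real.tan_eq_sin_div_cos, Real.sin_sub_pi_div_two, Real.cos_sub_pi_div_two, zero_sub]
  rw [boundaryAngle, h, Real.arctan_tan (by nlinarith [Real.pi_pos, hθ.1])
    (by nlinarith [Real.pi_pos, hθ.2])]
  ring

lemma monotone_boundaryAngle (hθ : θ ∈ Ioo (0 : ℝ) 1) : Monotone (boundaryAngle θ) := by
  intro w w' h
  have hs := sin_pi_mul_pos hθ
  unfold boundaryAngle
  have := Real.arctan_mono (div_le_div_of_nonneg_right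
    (sub_le_sub_right h (Real.cos (π * θ))) hs.le)
  linarith

lemma continuous_boundaryAngle : Continuous (boundaryAngle θ) := by
  unfold boundaryAngle
  fun_prop

lemma boundaryAngle_mem_Icc_of_nonneg (hθ : θ ∈ Ioo (0 : ℝ) 1) {w : ℝ} (hw : 0 ≤ w) :
    boundaryAngle θ w ∈ Icc (2 * π * θ) (2 * π) :=
  ⟨boundaryAngle_zero hθ ▸ monotone_boundaryAngle hθ hw, (boundaryAngle_lt w).le⟩

lemma boundaryAngle_mem_Icc_of_nonpos (hθ : θ ∈ Ioo (0 : ℝ) 1) {w : ℝ} (hw : w ≤ 0) :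
    boundaryAngle θ w ∈ Icc 0 (2 * π * θ) :=
  ⟨(boundaryAngle_pos w).le, boundaryAngle_zero hθ ▸ monotone_boundaryAngle hθ hw⟩

lemma im_cexp_pi_mul_I_mul (z : ℂ) :
    (cexp (π * I * z)).im = Real.exp (-(π * z.im)) * Real.sin (π * z.re) := by
  simp [Complex.exp_im]

lemma im_cexp_nonneg {z : ℂ} (hz : z ∈ re ⁻¹' Icc (0 : ℝ) 1) : 0 ≤ (cexp (π * I * z)).im := by
  rw [im_cexp_pi_mul_I_mul]
  exact mul_nonneg (Real.exp_pos _).le (Real.sin_nonneg_of_nonneg_of_le_pi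
    (mul_nonneg Real.pi_pos.le hz.1) (by nlinarith [Real.pi_pos, hz.2]))

lemma im_cexp_pos {z : ℂ} (hz : z ∈ re ⁻¹' Ioo (0 : ℝ) 1) : 0 < (cexp (π * I * z)).im := by
  rw [im_cexp_pi_mul_I_mul]
  exact mul_pos (Real.exp_pos _) (sin_pi_mul_pos hz)

lemma norm_stripToDisk_le_one (hθ : θ ∈ Ioo (0 : ℝ) 1) {z : ℂ} (hz : z ∈ re ⁻¹' Icc (0 : ℝ) 1) :
    ‖stripToDisk θ z‖ ≤ 1 :=
  norm_halfPlaneToDisk_le_one hθ (im_cexp_nonneg hz)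

lemma norm_stripToDisk_lt_one (hθ : θ ∈ Ioo (0 : ℝ) 1) {z : ℂ} (hz : z ∈ re ⁻¹' Ioo (0 : ℝ) 1) :
    ‖stripToDisk θ z‖ < 1 :=
  norm_halfPlaneToDisk_lt_one hθ (im_cexp_pos hz)

lemma differentiableAt_stripToDisk (hθ : θ ∈ Ioo (0 : ℝ) 1) {z : ℂ}
    (hz : z ∈ re ⁻¹' Icc (0 : ℝ) 1) : DifferentiableAt ℂ (stripToDisk θ) z :=
  (hasDerivAt_halfPlaneToDisk hθ (im_cexp_nonneg hz)).differentiableAt.comp z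
    (f := fun z => cexp (π * I * z)) (by fun_prop)

lemma stripToDisk_self : stripToDisk θ θ = 0 := by
  have : (π * I * θ : ℂ) = ((π * θ : ℝ) : ℂ) * I := by push_cast; ring
  rw [stripToDisk, halfPlaneToDisk, this, Complex.exp_mul_I, ← Complex.ofReal_cos,
    ← Complex.ofReal_sin, sub_self, zero_div]

lemma stripToDisk_mul_I (t : ℝ) :
    stripToDisk θ (t * I) = halfPlaneToDisk θ (Real.exp (-π * t) : ℝ) := by
  have : (π * I * (t * I) : ℂ) = ((-π * t : ℝ) : ℂ) := by
    push_cast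
    linear_combination (π * t : ℂ) * I_sq
  rw [stripToDisk, this, ← Complex.ofReal_exp]

lemma stripToDisk_one_add_mul_I (t : ℝ) :
    stripToDisk θ (1 + t * I) = halfPlaneToDisk θ (-Real.exp (-π * t) : ℝ) := by
  have : (π * I * (1 + t * I) : ℂ) = π * I + ((-π * t : ℝ) : ℂ) := by
    push_cast
    linear_combination (π * t : ℂ) * I_sq
  rw [stripToDisk, this, Complex.exp_add, Complex.exp_pi_mul_I, ← Complex.ofReal_exp, neg_one_mul,
    Complex.ofReal_neg]

lemma norm_deriv_halfPlaneToDisk_mul_le (hθ : θ ∈ Ioo (0 : ℝ) 1) (w : ℝ) :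
    ‖(2 * Real.sin (π * θ) * I) / ((w : ℂ) - (Real.cos (π * θ) - Real.sin (π * θ) * I)) ^ 2 *
      ((π * w : ℝ) : ℂ)‖ ≤ π / (1 - |Real.cos (π * θ)|) := by
  have hs := sin_pi_mul_pos hθ
  have hs1 := Real.sin_le_one (π * θ)
  set c := Real.cos (π * θ)
  set s := Real.sin (π * θ)
  have hcs : s ^ 2 + c ^ 2 = 1 := Real.sin_sq_add_cos_sq _
  have hc : |c| < 1 := by
    rw [← sq_lt_one_iff_abs_lt_one]
    nlinarith
  have hnorm : ‖((w : ℂ) - (c - s * I))‖ ^ 2 = w ^ 2 - 2 * w * c + 1 := by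
    rw [← Complex.normSq_eq_norm_sq, Complex.normSq_apply]
    simp only [sub_re, ofReal_re, mul_re, I_re, I_im, ofReal_im, sub_im, mul_im]
    linear_combination hcs
  have hden := norm_pos_iff.2 (halfPlaneToDisk_den_ne_zero hθ (w := (w : ℂ)) (by simp))
  have hlow : 2 * |w| * (1 - |c|) ≤ w ^ 2 - 2 * w * c + 1 := by
    have h1 : w * c ≤ |w| * |c| := (le_abs_self _).trans (abs_mul _ _).le
    nlinarith [sq_nonneg (|w| - 1), sq_abs w]
  have hD : 0 < w ^ 2 - 2 * w * c + 1 := hnorm ▸ pow_pos hden 2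
  rw [norm_mul, norm_div, norm_pow, hnorm, norm_mul, norm_mul, Complex.norm_I,
    Complex.norm_real, Complex.norm_real, Complex.norm_two, Real.norm_of_nonneg hs.le,
    Real.norm_eq_abs, abs_mul, abs_of_pos Real.pi_pos, div_mul_eq_mul_div,
    div_le_div_iff₀ hD (by linarith)]
  calc 2 * s * 1 * (π * |w|) * (1 - |c|) = s * (π * (2 * |w| * (1 - |c|))) := by ring
    _ ≤ 1 * (π * (2 * |w| * (1 - |c|))) := by
        have : 0 ≤ 1 - |c| := by linarith
        gcongr
    _ ≤ π * (w ^ 2 - 2 * w * c + 1) := by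
        rw [one_mul]
        gcongr

lemma norm_halfPlaneToDisk_real_exp_sub_le (hθ : θ ∈ Ioo (0 : ℝ) 1) (η s t : ℝ) :
    ‖halfPlaneToDisk θ (η * Real.exp (-π * s) : ℝ) - halfPlaneToDisk θ (η * Real.exp (-π * t) : ℝ)‖
      ≤ π / (1 - |Real.cos (π * θ)|) * |t - s| := by
  have hder : ∀ t : ℝ, HasDerivAt (fun t : ℝ => ((η * Real.exp (-π * t) : ℝ) : ℂ))
      ((-(π * (η * Real.exp (-π * t))) : ℝ) : ℂ) t := fun t => by
    refine HasDerivAt.ofReal_comp ?_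
    have h := (((hasDerivAt_id t).const_mul (-π)).exp).const_mul η
    refine h.congr_deriv ?_
    simp only [id]
    ring
  have key := Convex.norm_image_sub_le_of_norm_hasDerivWithin_le (s := univ) (x := t) (y := s)
    (f := fun t : ℝ => halfPlaneToDisk θ (η * Real.exp (-π * t) : ℝ))
    (C := π / (1 - |Real.cos (π * θ)|))
    (fun t _ => ((hasDerivAt_halfPlaneToDisk hθ (Complex.ofReal_im _).ge).comp_of_eq t
      (hder t) rfl).hasDerivWithinAt) (fun t _ => ?_) convex_univ (mem_univ _) (mem_univ _)
  · rwa [Real.norm_eq_abs, abs_sub_comm s t] at key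
  · rw [Complex.ofReal_neg, mul_neg, norm_neg]
    exact norm_deriv_halfPlaneToDisk_mul_le hθ _

end ConformalMap

section Pairing

variable {i0 : X0 →L[ℂ] E} {i1 : X1 →L[ℂ] E} {h : ℂ → (interSub i0 i1 →ₗ[ℂ] ℂ)} {C : ℝ}

lemma nzero_rpow_mul_none_rpow_le_norm (b : interSub i0 i1) {s : ℝ} (hs : s ∈ Icc (0 : ℝ) 1) :
    nzero i0 i1 b ^ (1 - s) * none' i0 i1 b ^ s ≤ ‖b‖ := by
  have h0 : nzero i0 i1 b ≤ ‖b‖ := norm_fst_le (b : X0 × X1)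
  have h1 : none' i0 i1 b ≤ ‖b‖ := norm_snd_le (b : X0 × X1)
  have hs' : 0 ≤ 1 - s := by linarith [hs.2]
  calc _ ≤ ‖b‖ ^ (1 - s) * ‖b‖ ^ s :=
        mul_le_mul (Real.rpow_le_rpow (norm_nonneg _) h0 hs')
          (Real.rpow_le_rpow (norm_nonneg _) h1 hs.1) (Real.rpow_nonneg (norm_nonneg _) _)
          (Real.rpow_nonneg (norm_nonneg _) _)
    _ = ‖b‖ := by
        rw [← Real.rpow_add_of_nonneg (norm_nonneg _) hs' hs.1, sub_add_cancel, Real.rpow_one]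

lemma isOpen_Sopen : IsOpen Sopen := isOpen_Ioo.preimage Complex.continuous_re

lemma norm_apply_le_mul_norm (hC0 : 0 ≤ C)
    (hC : ∀ b : interSub i0 i1, ∀ z ∈ Sopen,
      ‖h z b‖ ≤ C * nzero i0 i1 b ^ (1 - z.re) * none' i0 i1 b ^ z.re)
    (b : interSub i0 i1) {z : ℂ} (hz : z ∈ Sopen) : ‖h z b‖ ≤ C * ‖b‖ := by
  refine (hC b z hz).trans ?_
  rw [mul_assoc]
  exact mul_le_mul_of_nonneg_left
    (nzero_rpow_mul_none_rpow_le_norm b ⟨hz.1.le, hz.2.le⟩) hC0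

/-- The pairing of a weakly analytic, uniformly bounded family of functionals with an analytic
function is analytic. -/
lemma differentiableOn_pairing (hC0 : 0 ≤ C)
    (hd : ∀ b : interSub i0 i1, DifferentiableOn ℂ (fun z => h z b) Sopen)
    (hC : ∀ b : interSub i0 i1, ∀ z ∈ Sopen,
      ‖h z b‖ ≤ C * nzero i0 i1 b ^ (1 - z.re) * none' i0 i1 b ^ z.re)
    {P : ℂ → interSub i0 i1}
    (hP0 : DifferentiableOn ℂ (fun z => (P z : X0 × X1).1) Sopen)
    (hP1 : DifferentiableOn ℂ (fun z => (P z : X0 × X1).2) Sopen) :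
    DifferentiableOn ℂ (fun z => h z (P z)) Sopen := by
  intro w hw
  have hnhds : Sopen ∈ 𝓝 w := isOpen_Sopen.mem_nhds hw
  have hD0 := (hP0.differentiableAt hnhds).hasDerivAt
  have hD1 := (hP1.differentiableAt hnhds).hasDerivAt
  set D0 := deriv (fun z => (P z : X0 × X1).1) w
  set D1 := deriv (fun z => (P z : X0 × X1).2) w
  have hmem : i0 D0 = i1 D1 := by
    have e0 := i0.hasFDerivAt.comp_hasDerivAt w hD0
    have e1 := i1.hasFDerivAt.comp_hasDerivAt w hD1
    have e : (i0 ∘ fun z => (P z : X0 × X1).1) = i1 ∘ fun z => (P z : X0 × X1).2 :=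
      funext fun z => (P z).2
    rw [e] at e0
    exact e0.unique e1
  set d : interSub i0 i1 := ⟨(D0, D1), hmem⟩
  set R : ℂ → interSub i0 i1 := fun z => P z - P w - (z - w) • d
  have hR : R =o[𝓝 w] fun z => z - w := by
    have := (hasDerivAt_iff_isLittleO.1 hD0).prod_left (hasDerivAt_iff_isLittleO.1 hD1)
    exact (Asymptotics.isLittleO_iff.2 fun c hc => Asymptotics.isLittleO_iff.1 this hc)
  have hRh : HasDerivAt (fun z => h z (R z)) 0 w := by
    rw [hasDerivAt_iff_isLittleO]
    have hRw : R w = 0 := by simp [R]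
    simp only [hRw, map_zero, sub_zero, smul_zero]
    refine Asymptotics.IsBigO.trans_isLittleO (Asymptotics.IsBigO.of_bound C ?_) hR
    filter_upwards [hnhds] with z hz
    exact norm_apply_le_mul_norm hC0 hC _ hz
  have hsum := (hRh.differentiableAt.add ((hd (P w)).differentiableAt hnhds)).add
    (((differentiableAt_id (𝕜 := ℂ) (x := w)).sub_const w).mul ((hd d).differentiableAt hnhds))
  refine (hsum.congr_of_eventuallyEq (Eventually.of_forall fun z => ?_)).differentiableWithinAt
  have : P z = R z + P w + (z - w) • d := by simp only [R]; abel
  simp only [Pi.add_apply, Pi.mul_apply, id]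
  conv_lhs => rw [this]
  rw [map_add, map_add, map_smul, smul_eq_mul]

open HadamardThreeLines in
/-- Three lines estimate for the pairing: the bounds of the two components on the respective
boundary lines control the pairing in the interior of the strip. -/
lemma norm_pairing_le {θ : ℝ} (hθ : θ ∈ Ioo (0 : ℝ) 1) (hC0 : 0 ≤ C)
    (hd : ∀ b : interSub i0 i1, DifferentiableOn ℂ (fun z => h z b) Sopen)
    (hC : ∀ b : interSub i0 i1, ∀ z ∈ Sopen,
      ‖h z b‖ ≤ C * nzero i0 i1 b ^ (1 - z.re) * none' i0 i1 b ^ z.re)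
    {P : ℂ → interSub i0 i1}
    (hP0 : ∀ z ∈ re ⁻¹' Icc (0 : ℝ) 1, DifferentiableAt ℂ (fun z => (P z : X0 × X1).1) z)
    (hP1 : ∀ z ∈ re ⁻¹' Icc (0 : ℝ) 1, DifferentiableAt ℂ (fun z => (P z : X0 × X1).2) z)
    {L M : ℝ} (hM0 : 0 < M)
    (hL0 : ∀ z ∈ re ⁻¹' Icc (0 : ℝ) 1, ‖(P z : X0 × X1).1‖ ≤ L)
    (hL1 : ∀ z ∈ re ⁻¹' Icc (0 : ℝ) 1, ‖(P z : X0 × X1).2‖ ≤ L)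
    (hM : ∀ t : ℝ, ‖(P (t * I) : X0 × X1).1‖ ≤ M)
    (hM' : ∀ t : ℝ, ‖(P (1 + t * I) : X0 × X1).2‖ ≤ M) :
    ‖h θ (P θ)‖ ≤ C * M := by
  wlog hLpos : 0 < L generalizing L
  · exact this (L := |L| + 1) (fun z hz => (hL0 z hz).trans (by linarith [le_abs_self L]))
      (fun z hz => (hL1 z hz).trans (by linarith [le_abs_self L])) (by positivity)
  have hcl : ∀ a b : ℝ, closure (verticalStrip a b) ⊆ re ⁻¹' Icc a b := fun a b =>
    closure_minimal (preimage_mono Ioo_subset_Icc_self) (isClosed_Icc.preimage Complex.continuous_re)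
  have hline0 : ∀ z ∈ re ⁻¹' {(0 : ℝ)}, z = z.im * I := fun z hz => by
    have : z.re = 0 := hz
    apply Complex.ext <;> simp [this]
  have hline1 : ∀ z ∈ re ⁻¹' {(1 : ℝ)}, z = 1 + z.im * I := fun z hz => by
    have : z.re = 1 := hz
    apply Complex.ext <;> simp [this]
  have b0 : ∀ z ∈ re ⁻¹' Icc (0 : ℝ) 1, ‖(P z : X0 × X1).1‖ ≤ M ^ (1 - z.re) * L ^ z.re := by
    intro z hz
    refine norm_le_interp_of_mem_verticalClosedStrip₀₁' (fun z => (P z : X0 × X1).1) hz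
      (DifferentiableOn.diffContOnCl fun w hw => (hP0 w (hcl 0 1 hw)).differentiableWithinAt)
      ⟨L, ?_⟩ (fun w hw => ?_) (fun w hw => ?_)
    · rintro _ ⟨w, hw, rfl⟩
      exact hL0 w hw
    · rw [hline0 w hw]
      exact hM _
    · rw [hline1 w hw]
      exact hL0 _ (by simp)
  have b1 : ∀ z ∈ re ⁻¹' Icc (0 : ℝ) 1, ‖(P z : X0 × X1).2‖ ≤ L ^ (1 - z.re) * M ^ z.re := by
    intro z hz
    refine norm_le_interp_of_mem_verticalClosedStrip₀₁' (fun z => (P z : X0 × X1).2) hz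
      (DifferentiableOn.diffContOnCl fun w hw => (hP1 w (hcl 0 1 hw)).differentiableWithinAt)
      ⟨L, ?_⟩ (fun w hw => ?_) (fun w hw => ?_)
    · rintro _ ⟨w, hw, rfl⟩
      exact hL1 w hw
    · rw [hline0 w hw]
      exact hL1 _ (by simp)
    · rw [hline1 w hw]
      exact hM' _
  set Φ : ℝ → ℝ := fun s => (M ^ (1 - s) * L ^ s) ^ (1 - s) * (L ^ (1 - s) * M ^ s) ^ s with hΦ
  have hΦ0 : ∀ s, 0 ≤ Φ s := fun s => by simp only [hΦ]; positivity
  have hΦsymm : ∀ s, Φ (1 - s) = Φ s := fun s => by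
    simp only [hΦ, sub_sub_cancel]
    rw [mul_comm, mul_comm (L ^ s), mul_comm (M ^ s)]
  have hu : ∀ z ∈ Sopen, ‖h z (P z)‖ ≤ C * Φ z.re := by
    intro z hz
    have hz' : z ∈ re ⁻¹' Icc (0 : ℝ) 1 := ⟨hz.1.le, hz.2.le⟩
    refine (hC (P z) z hz).trans ?_
    rw [mul_assoc]
    refine mul_le_mul_of_nonneg_left (mul_le_mul ?_ ?_ ?_ (by positivity)) hC0
    · exact Real.rpow_le_rpow (norm_nonneg _) (b0 z hz') (by linarith [hz.2])
    · exact Real.rpow_le_rpow (norm_nonneg _) (b1 z hz') hz.1.le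
    · exact Real.rpow_nonneg (norm_nonneg _) _
  have hsub : Sopen ⊆ re ⁻¹' Icc (0 : ℝ) 1 := fun z hz => ⟨hz.1.le, hz.2.le⟩
  have hdiff := differentiableOn_pairing hC0 hd hC
    (fun z hz => (hP0 z (hsub hz)).differentiableWithinAt)
    (fun z hz => (hP1 z (hsub hz)).differentiableWithinAt)
  have hδ : ∀ δ : ℝ, 0 < δ → δ < θ → δ < 1 - θ → ‖h θ (P θ)‖ ≤ C * Φ δ := by
    intro δ h0 h1 h2
    have hstrip : re ⁻¹' Icc δ (1 - δ) ⊆ Sopen := fun z hz =>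
      ⟨h0.trans_le hz.1, hz.2.trans_lt (by linarith)⟩
    have hlt : δ < 1 - δ := by linarith
    have hx0 : 0 ≤ (θ - δ) / (1 - δ - δ) := div_nonneg (by linarith) (by linarith)
    have hx1 : (θ - δ) / (1 - δ - δ) ≤ 1 := by
      rw [div_le_one (by linarith)]
      linarith
    have key := norm_le_interp_of_mem_verticalClosedStrip' (f := fun z => h z (P z)) (z := (θ : ℂ))
      (a := C * Φ δ) (b := C * Φ δ) hlt ⟨by simpa using h1.le, by simp; linarith⟩
      (hdiff.mono ((hcl _ _).trans hstrip)).diffContOnCl ⟨C * L, ?_⟩ (fun z hz => ?_)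
      (fun z hz => ?_)
    · rwa [Complex.ofReal_re, ← Real.rpow_add_of_nonneg (mul_nonneg hC0 (hΦ0 δ)) (by linarith) hx0,
        sub_add_cancel, Real.rpow_one] at key
    · rintro _ ⟨z, hz, rfl⟩
      have hz' := hstrip hz
      refine (norm_apply_le_mul_norm hC0 hC _ hz').trans (mul_le_mul_of_nonneg_left ?_ hC0)
      exact norm_prod_le_iff.2 ⟨hL0 z (hsub hz'), hL1 z (hsub hz')⟩
    · have hz' : z.re = δ := hz
      have := hu z (hstrip ⟨hz'.ge, by rw [hz']; exact hlt.le⟩)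
      rwa [hz'] at this
    · have hz' : z.re = 1 - δ := hz
      have := hu z (hstrip ⟨by rw [hz']; exact hlt.le, hz'.le⟩)
      rwa [hz', hΦsymm] at this
  have hcont : Continuous Φ := by
    have hne : ∀ a b : ℝ, M ^ a * L ^ b ≠ 0 := fun a b => by positivity
    have hMc : ∀ g : ℝ → ℝ, Continuous g → Continuous fun s => M ^ g s := fun g hg =>
      continuous_const.rpow hg fun _ => Or.inl hM0.ne'
    have hLc : ∀ g : ℝ → ℝ, Continuous g → Continuous fun s => L ^ g s := fun g hg =>
      continuous_const.rpow hg fun _ => Or.inl hLpos.ne'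
    have h1s : Continuous fun s : ℝ => 1 - s := by fun_prop
    refine (((hMc _ h1s).mul (hLc _ continuous_id)).rpow h1s fun s => Or.inl (hne _ _)).mul
      (((hLc _ h1s).mul (hMc _ continuous_id)).rpow continuous_id fun s => Or.inl ?_)
    rw [mul_comm]
    exact hne _ _
  have hlim : Tendsto (fun δ => C * Φ δ) (𝓝[>] 0) (𝓝 (C * M)) := by
    have h0 : Φ 0 = M := by simp [hΦ]
    have := (hcont.tendsto 0).const_mul C
    rw [h0] at this
    exact this.mono_left nhdsWithin_le_nhds
  refine ge_of_tendsto hlim ?_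
  filter_upwards [self_mem_nhdsWithin, nhdsWithin_le_nhds (Iio_mem_nhds hθ.1),
    nhdsWithin_le_nhds (Iio_mem_nhds (sub_pos.2 hθ.2))] with δ a b c
  exact hδ δ a b c

end Pairing

section DiskFunctions

lemma map_gaussMoll {V W : Type*} [NormedAddCommGroup V] [NormedSpace ℂ V] [CompleteSpace V]
    [NormedAddCommGroup W] [NormedSpace ℂ W] [CompleteSpace W] (i : V →L[ℂ] W) {n : ℝ} (hn : 0 < n)
    {k : ℝ → V} (hk : Continuous k) {B : ℝ} (hB : ∀ t, ‖k t‖ ≤ B) (z : ℂ) :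
    i (gaussMoll n k z) = gaussMoll n (fun t => i (k t)) z := by
  simp only [gaussMoll, map_smul,
    ← i.integral_comp_comm (integrable_gaussKernel_smul hn hk hB z)]

variable {θ : ℝ} {i0 : X0 →L[ℂ] E} {i1 : X1 →L[ℂ] E}

lemma CalderonDiskFun.norm_g0_le (f : CalderonDiskFun θ i0 i1) {t : ℝ}
    (ht : t ∈ Icc (2 * π * θ) (2 * π)) : ‖f.g0 t‖ ≤ f.norm :=
  (le_csSup (isCompact_Icc.bddAbove_image f.cont_g0.norm) (mem_image_of_mem _ ht)).trans
    (le_max_left _ _)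

lemma CalderonDiskFun.norm_g1_le (f : CalderonDiskFun θ i0 i1) {t : ℝ}
    (ht : t ∈ Icc 0 (2 * π * θ)) : ‖f.g1 t‖ ≤ f.norm :=
  (le_csSup (isCompact_Icc.bddAbove_image f.cont_g1.norm) (mem_image_of_mem _ ht)).trans
    (le_max_right _ _)

lemma CalderonDiskFun.norm_nonneg (hθ : θ ∈ Ioo (0 : ℝ) 1) (f : CalderonDiskFun θ i0 i1) :
    0 ≤ f.norm :=
  (_root_.norm_nonneg _).trans
    (f.norm_g1_le (left_mem_Icc.2 (mul_nonneg Real.two_pi_pos.le hθ.1.le)))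

lemma exists_calderonDiskFun (p : interSub i0 i1) :
    ∃ f : CalderonDiskFun θ i0 i1, f.toFun 0 = i0 (p : X0 × X1).1 := by
  set u : ℂ → ℂ := fun z => (1 - z) * (1 - z * cexp (-((2 * π * θ : ℝ) * I)))
  have hu : Differentiable ℂ u := by fun_prop
  refine ⟨{ toFun := fun z => u z • i0 (p : X0 × X1).1
            g0 := fun t => u (cexp (t * I)) • (p : X0 × X1).1
            g1 := fun t => u (cexp (t * I)) • (p : X0 × X1).2
            cont := (hu.continuous.smul continuous_const).continuousOn
            anal := (hu.smul_const _).differentiableOn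
            vanish_one := by simp [u]
            vanish_theta := by simp only [u, ← Complex.exp_add]; simp
            cont_g0 := ((hu.continuous.comp (by fun_prop)).smul continuous_const).continuousOn
            cont_g1 := ((hu.continuous.comp (by fun_prop)).smul continuous_const).continuousOn
            eq_g0 := fun t _ => map_smul _ _ _
            eq_g1 := fun t _ => ?_ }, by simp [u]⟩
  have hp : i0 (p : X0 × X1).1 = i1 (p : X0 × X1).2 := p.2
  rw [map_smul, hp]

/-- A functional on `X₀ ∩ X₁` in the range of an `ℋ`-function with constant `C` is bounded by
`C` times the norm of any Calderón function representing the argument. -/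
lemma norm_apply_le_mul_calderonNorm [CompleteSpace X0] [CompleteSpace X1] [CompleteSpace E]
    (hθ : θ ∈ Ioo (0 : ℝ) 1) {h : ℂ → (interSub i0 i1 →ₗ[ℂ] ℂ)} {C : ℝ} (hC0 : 0 ≤ C)
    (hd : ∀ b : interSub i0 i1, DifferentiableOn ℂ (fun z => h z b) Sopen)
    (hC : ∀ b : interSub i0 i1, ∀ z ∈ Sopen,
      ‖h z b‖ ≤ C * nzero i0 i1 b ^ (1 - z.re) * none' i0 i1 b ^ z.re)
    (f : CalderonDiskFun θ i0 i1) {p : interSub i0 i1} (hfp : f.toFun 0 = i0 (p : X0 × X1).1) :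
    ‖h θ p‖ ≤ C * f.norm := by
  have hp : i0 (p : X0 × X1).1 = i1 (p : X0 × X1).2 := p.2
  set ψ : ℂ → ℂ := stripToDisk θ with hψ
  set M : ℝ := f.norm
  set B : ℝ := M + ‖p‖
  set Λ : ℝ := π / (1 - |Real.cos (π * θ)|)
  have hM0 : 0 ≤ M := f.norm_nonneg hθ
  have hB0 : 0 ≤ B := add_nonneg hM0 (norm_nonneg _)
  have hψ1 : ∀ z ∈ re ⁻¹' Icc (0 : ℝ) 1, ‖ψ z‖ ≤ 1 := fun z hz => norm_stripToDisk_le_one hθ hz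
  have hψd : ∀ z ∈ re ⁻¹' Icc (0 : ℝ) 1, DifferentiableAt ℂ ψ z := fun z hz =>
    differentiableAt_stripToDisk hθ hz
  have hψc : ContinuousOn ψ (re ⁻¹' Icc (0 : ℝ) 1) := fun z hz =>
    (hψd z hz).continuousAt.continuousWithinAt
  -- the two boundary lines correspond to the two arcs
  set τ0 : ℝ → ℝ := fun t => boundaryAngle θ (Real.exp (-π * t))
  set τ1 : ℝ → ℝ := fun t => boundaryAngle θ (-Real.exp (-π * t))
  have hτ0 : ∀ t, τ0 t ∈ Icc (2 * π * θ) (2 * π) := fun t =>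
    boundaryAngle_mem_Icc_of_nonneg hθ (Real.exp_pos _).le
  have hτ1 : ∀ t, τ1 t ∈ Icc 0 (2 * π * θ) := fun t =>
    boundaryAngle_mem_Icc_of_nonpos hθ (neg_nonpos.2 (Real.exp_pos _).le)
  have hψ0τ : ∀ t : ℝ, ψ (t * I) = cexp (τ0 t * I) := fun t => by
    rw [hψ, stripToDisk_mul_I, halfPlaneToDisk_ofReal hθ]
  have hψ1τ : ∀ t : ℝ, ψ (1 + t * I) = cexp (τ1 t * I) := fun t => by
    rw [hψ, stripToDisk_one_add_mul_I, halfPlaneToDisk_ofReal hθ]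
  have hτ0c : Continuous τ0 := continuous_boundaryAngle.comp (by fun_prop)
  have hτ1c : Continuous τ1 := continuous_boundaryAngle.comp (by fun_prop)
  have hLip0 : ∀ s t : ℝ, ‖ψ (s * I) - ψ (t * I)‖ ≤ Λ * |t - s| := fun s t => by
    have := norm_halfPlaneToDisk_real_exp_sub_le hθ 1 s t
    simpa only [hψ, stripToDisk_mul_I, one_mul] using this
  have hLip1 : ∀ s t : ℝ, ‖ψ (1 + s * I) - ψ (1 + t * I)‖ ≤ Λ * |t - s| := fun s t => by
    have := norm_halfPlaneToDisk_real_exp_sub_le hθ (-1) s t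
    simpa only [hψ, stripToDisk_one_add_mul_I, neg_one_mul] using this
  -- the quotient `(f - f 0) / z` in the strip picture, and its boundary functions
  set K : ℂ → E := fun z => dslope f.toFun 0 (ψ z) with hK
  have hball : Metric.closedBall (0 : ℂ) 1 ∈ 𝓝 (0 : ℂ) := Metric.closedBall_mem_nhds _ one_pos
  have hball' : Metric.ball (0 : ℂ) 1 ∈ 𝓝 (0 : ℂ) := Metric.ball_mem_nhds _ one_pos
  have hqc : ContinuousOn (dslope f.toFun 0) (Metric.closedBall 0 1) :=
    (continuousOn_dslope hball).2 ⟨f.cont, f.anal.differentiableAt hball'⟩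
  have hqd : DifferentiableOn ℂ (dslope f.toFun 0) (Metric.ball 0 1) :=
    (differentiableOn_dslope hball').2 f.anal
  have hmaps : MapsTo ψ (re ⁻¹' Icc (0 : ℝ) 1) (Metric.closedBall 0 1) := fun z hz =>
    mem_closedBall_zero_iff.2 (hψ1 z hz)
  have hKc : ContinuousOn K (re ⁻¹' Icc 0 1) := hqc.comp hψc hmaps
  have hKd : DifferentiableOn ℂ K (re ⁻¹' Ioo 0 1) :=
    hqd.comp (fun z hz => (hψd z (Ioo_subset_Icc_self hz)).differentiableWithinAt)
      fun z hz => mem_ball_zero_iff.2 (norm_stripToDisk_lt_one hθ hz)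
  obtain ⟨BK, hBK⟩ := (isCompact_closedBall (0 : ℂ) 1).exists_bound_of_continuousOn hqc
  have hKb : ∀ z ∈ re ⁻¹' Icc (0 : ℝ) 1, ‖K z‖ ≤ BK := fun z hz => hBK _ (hmaps hz)
  have hKexp : ∀ τ : ℝ, dslope f.toFun 0 (cexp (τ * I)) =
      (cexp (τ * I))⁻¹ • (f.toFun (cexp (τ * I)) - f.toFun 0) := fun τ => by
    rw [dslope_of_ne _ (Complex.exp_ne_zero _), slope_def_module, sub_zero]
  set k0 : ℝ → X0 := fun t => (cexp (τ0 t * I))⁻¹ • (f.g0 (τ0 t) - (p : X0 × X1).1)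
  set k1 : ℝ → X1 := fun t => (cexp (τ1 t * I))⁻¹ • (f.g1 (τ1 t) - (p : X0 × X1).2)
  have hik0 : ∀ t, i0 (k0 t) = K (t * I) := fun t => by
    simp only [k0, hK, hψ0τ, hKexp, map_smul, map_sub, hfp, f.eq_g0 _ (hτ0 t)]
  have hik1 : ∀ t, i1 (k1 t) = K (1 + t * I) := fun t => by
    simp only [k1, hK, hψ1τ, hKexp, map_smul, map_sub, hfp, hp, f.eq_g1 _ (hτ1 t)]
  have hk0c : Continuous k0 :=
    (Continuous.inv₀ (by fun_prop) fun t => Complex.exp_ne_zero _).smul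
      ((f.cont_g0.comp_continuous hτ0c hτ0).sub continuous_const)
  have hk1c : Continuous k1 :=
    (Continuous.inv₀ (by fun_prop) fun t => Complex.exp_ne_zero _).smul
      ((f.cont_g1.comp_continuous hτ1c hτ1).sub continuous_const)
  have hk0B : ∀ t, ‖k0 t‖ ≤ B := fun t => by
    simp only [k0, norm_smul, norm_inv, Complex.norm_exp_ofReal_mul_I, inv_one, one_mul]
    exact (norm_sub_le _ _).trans
      (add_le_add (f.norm_g0_le (hτ0 t)) (norm_fst_le (p : X0 × X1)))
  have hk1B : ∀ t, ‖k1 t‖ ≤ B := fun t => by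
    simp only [k1, norm_smul, norm_inv, Complex.norm_exp_ofReal_mul_I, inv_one, one_mul]
    exact (norm_sub_le _ _).trans
      (add_le_add (f.norm_g1_le (hτ1 t)) (norm_snd_le (p : X0 × X1)))
  have hbd0 : ∀ t : ℝ, ‖(p : X0 × X1).1 + ψ (t * I) • k0 t‖ ≤ M := fun t => by
    simp only [k0, hψ0τ, smul_inv_smul₀ (Complex.exp_ne_zero _), add_sub_cancel]
    exact f.norm_g0_le (hτ0 t)
  have hbd1 : ∀ t : ℝ, ‖(p : X0 × X1).2 + ψ (1 + t * I) • k1 t‖ ≤ M := fun t => by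
    simp only [k1, hψ1τ, smul_inv_smul₀ (Complex.exp_ne_zero _), add_sub_cancel]
    exact f.norm_g1_le (hτ1 t)
  -- mollified competitors with values in the intersection and value `p` at `θ`
  have hn : ∀ n : ℝ, 0 < n →
      ‖h θ p‖ ≤ C * (M + Λ * B * (√(n / π) * (1 / n)) + √(n / π) * (1 / n)) := by
    intro n hn
    have hε : 0 < √(n / π) * (1 / n) := by positivity
    have hmem : ∀ z, i0 ((p : X0 × X1).1 + ψ z • gaussMoll n k0 z) =
        i1 ((p : X0 × X1).2 + ψ z • gaussMoll n k1 (z - 1)) := fun z => by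
      rw [map_add, map_add, map_smul, map_smul, map_gaussMoll i0 hn hk0c hk0B,
        map_gaussMoll i1 hn hk1c hk1B, hp]
      simp only [hik0, hik1]
      rw [gaussMoll_boundary_eq hn hKc hKd hKb]
    set P : ℂ → interSub i0 i1 := fun z => ⟨((p : X0 × X1).1 + ψ z • gaussMoll n k0 z,
      (p : X0 × X1).2 + ψ z • gaussMoll n k1 (z - 1)), hmem z⟩
    have hPθ : P θ = p := by
      have h0 : ψ θ = 0 := stripToDisk_self
      apply Subtype.ext
      simp [P, h0]
    have hd0 := differentiable_gaussMoll hn hk0c hk0B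
    have hd1 := (differentiable_gaussMoll hn hk1c hk1B).comp
      (differentiable_id.sub_const (1 : ℂ))
    have hexp : ∀ s : ℝ, |s| ≤ 1 → Real.exp (n * s ^ 2) * B ≤ Real.exp n * B := fun s hs => by
      have : s ^ 2 ≤ 1 := (sq_le_one_iff_abs_le_one s).2 hs
      gcongr
      nlinarith
    have hpair := norm_pairing_le (P := P) hθ hC0 hd hC (L := ‖p‖ + 1 * (Real.exp n * B))
      (M := M + Λ * B * (√(n / π) * (1 / n)) + √(n / π) * (1 / n))
      (fun z hz => ((hψd z hz).smul (hd0 z)).const_add _)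
      (fun z hz => ((hψd z hz).smul (hd1 z)).const_add _) ?_ ?_ ?_ ?_ ?_
    · rwa [hPθ] at hpair
    · have hΛ : 0 ≤ Λ := div_nonneg Real.pi_pos.le (sub_nonneg.2 (Real.abs_cos_le_one _))
      positivity
    · intro z hz
      refine (norm_add_le _ _).trans (add_le_add (norm_fst_le (p : X0 × X1)) ?_)
      rw [norm_smul]
      exact mul_le_mul (hψ1 z hz) ((norm_gaussMoll_le hn hk0B z).trans
        (hexp _ (abs_le.2 ⟨by linarith [hz.1], hz.2⟩))) (norm_nonneg _) zero_le_one
    · intro z hz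
      refine (norm_add_le _ _).trans (add_le_add (norm_snd_le (p : X0 × X1)) ?_)
      rw [norm_smul]
      refine mul_le_mul (hψ1 z hz) ((norm_gaussMoll_le hn hk1B (z - 1)).trans
        (hexp _ (abs_le.2 ?_))) (norm_nonneg _) zero_le_one
      rw [sub_re, one_re]
      exact ⟨by linarith [hz.1], by linarith [hz.2]⟩
    · intro t
      exact (norm_add_smul_gaussMoll_le hn hk0c hk0B (φ := fun t : ℝ => ψ (t * I)) hLip0 hbd0
        t).trans (le_add_of_nonneg_right hε.le)
    · intro t
      have := norm_add_smul_gaussMoll_le hn hk1c hk1B (φ := fun t : ℝ => ψ (1 + t * I)) hLip1 hbd1 t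
      simp only [P, add_sub_cancel_left]
      exact this.trans (le_add_of_nonneg_right hε.le)
  have hlim : Tendsto (fun n : ℝ =>
      C * (M + Λ * B * (√(n / π) * (1 / n)) + √(n / π) * (1 / n))) atTop (𝓝 (C * M)) := by
    have := (((tendsto_sqrt_div_pi_mul_one_div.const_mul (Λ * B)).const_add M).add
      tendsto_sqrt_div_pi_mul_one_div).const_mul C
    simpa using this
  exact ge_of_tendsto hlim ((eventually_gt_atTop 0).mono hn)

lemma upperNorm_nonneg (θ : ℝ) (i0 : X0 →L[ℂ] E) (i1 : X1 →L[ℂ] E)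
    (y : interSub i0 i1 →ₗ[ℂ] ℂ) : 0 ≤ upperNorm θ i0 i1 y := by
  refine Real.sInf_nonneg ?_
  rintro _ ⟨h, _, _, rfl⟩
  exact Real.sInf_nonneg fun _ hC => hC.1

lemma le_sInf_mul {S : Set ℝ} {a b : ℝ} (hb : 0 ≤ b) (hS : S.Nonempty)
    (hab : ∀ r ∈ S, a ≤ r * b) : a ≤ sInf S * b := by
  rcases hb.eq_or_lt with rfl | hb
  · obtain ⟨r, hr⟩ := hS
    simpa using hab r hr
  · rw [← div_le_iff₀ hb]
    exact le_csInf hS fun r hr => (div_le_iff₀ hb).2 (hab r hr)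

end DiskFunctions

/-- Calderón's duality theorem, first inclusion
`[X₀^#, X₁^#]^θ ⊂¹ ([X₀,X₁]_θ)^#`: if `y ∈ [X₀^#, X₁^#]^θ` then
`|⟨x, y⟩| ≤ ‖y‖_{[X₀^#,X₁^#]^θ} ‖x‖_{[X₀,X₁]_θ}` for all `x ∈ X₀ ∩ X₁`, and hence
`‖y‖_{([X₀,X₁]_θ)^#} ≤ ‖y‖_{[X₀^#,X₁^#]^θ}`. -/
theorem calderon_duality_first_inclusion
    [CompleteSpace X0] [CompleteSpace X1] [CompleteSpace E]
    (θ : ℝ) (hθ : θ ∈ Ioo (0:ℝ) 1)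
    (i0 : X0 →L[ℂ] E) (i1 : X1 →L[ℂ] E)
    (hi0 : Function.Injective i0) (hi1 : Function.Injective i1)
    (hreg0 : Dense {x : X0 | ∃ y : X1, i0 x = i1 y})
    (hreg1 : Dense {y : X1 | ∃ x : X0, i0 x = i1 y})
    (y : interSub i0 i1 →ₗ[ℂ] ℂ)
    (hy : ∃ h, MemH i0 i1 h ∧ h ((θ:ℝ) : ℂ) = y) :
    (∀ p : interSub i0 i1,
      ‖y p‖ ≤ upperNorm θ i0 i1 y * interpNorm θ i0 i1 (i0 (p : X0 × X1).1)) ∧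
    interpDualNorm θ i0 i1 y ≤ upperNorm θ i0 i1 y := by
  have hbound : ∀ p : interSub i0 i1,
      ‖y p‖ ≤ upperNorm θ i0 i1 y * interpNorm θ i0 i1 (i0 (p : X0 × X1).1) := by
    intro p
    have hf : ∀ f : CalderonDiskFun θ i0 i1, f.toFun 0 = i0 (p : X0 × X1).1 →
        ‖y p‖ ≤ upperNorm θ i0 i1 y * f.norm := by
      intro f hfp
      obtain ⟨h₀, hh₀, hy₀⟩ := hy
      refine le_sInf_mul (f.norm_nonneg hθ) ⟨_, h₀, hh₀, hy₀, rfl⟩ ?_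
      rintro _ ⟨h, hh, rfl, rfl⟩
      obtain ⟨C, hC⟩ := hh.2.2
      refine le_sInf_mul (f.norm_nonneg hθ) ⟨|C|, abs_nonneg C, fun b z hz => ?_⟩ ?_
      · refine (hC b z hz).trans ?_
        rw [mul_assoc, mul_assoc]
        exact mul_le_mul_of_nonneg_right (le_abs_self C)
          (mul_nonneg (Real.rpow_nonneg (norm_nonneg _) _) (Real.rpow_nonneg (norm_nonneg _) _))
      · rintro C ⟨hC0, hC⟩
        exact norm_apply_le_mul_calderonNorm hθ hC0 (fun b => (hh.2.1 b).1) hC f hfp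
    rw [mul_comm]
    obtain ⟨f, hfp⟩ := exists_calderonDiskFun (θ := θ) p
    refine le_sInf_mul (upperNorm_nonneg θ i0 i1 y) ⟨_, f, hfp, rfl⟩ ?_
    rintro _ ⟨f, hfp, rfl⟩
    rw [mul_comm]
    exact hf f hfp
  refine ⟨hbound, Real.sSup_le ?_ (upperNorm_nonneg θ i0 i1 y)⟩
  rintro _ ⟨p, hp, rfl⟩
  exact (hbound p).trans (mul_le_of_le_one_right (upperNorm_nonneg θ i0 i1 y) hp)
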